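/- For all η ∈ (0,1], b > 1, ε ∈ (0,1) and γ > 0 there exist constants α < ∞ and c > 0 such that the following holds. Let X_0, X_1, … be a martingale with values in (0,1] such that for every t, almost surely ℙ[X_{t+1} < X_t^b | X_0,…,X_t] ≥ η, and let T ≥ 1 be such that X_0 < exp(-γ·T) almost surely. Then ℙ[log X_T ≥ -b^{(1-ε)·η·T}] ≤ α·exp(-c·T). -/

import Mathlib

open MeasureTheory

/- The σ-algebra generated by `X_0, …, X_t`. -/
def pastSigma {Ω : Type} (X : ℕ → Ω → ℝ) (t : ℕ) : MeasurableSpace Ω :=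
  MeasurableSpace.comap (fun ω (i : Fin (t + 1)) => X i ω) inferInstance

section Auxiliary

variable {Ω : Type}

theorem pastSigma_le [m0 : MeasurableSpace Ω] {X : ℕ → Ω → ℝ} (hX : ∀ t, Measurable (X t))
    (t : ℕ) : pastSigma X t ≤ m0 :=
  Measurable.comap_le (measurable_pi_iff.2 fun i => hX i)

theorem measurable_pastSigma (X : ℕ → Ω → ℝ) {s t : ℕ} (hst : s ≤ t) :
    Measurable[pastSigma X t] (X s) := by
  have h : Measurable[pastSigma X t] (fun ω (i : Fin (t + 1)) => X i ω) :=
    comap_measurable _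
  exact (measurable_pi_apply (⟨s, Nat.lt_succ_of_le hst⟩ : Fin (t + 1))).comp h

/-- Integrating a nonnegative `m`-measurable function against `f` or against a version of
the conditional expectation of `f` gives the same value. -/
theorem lintegral_mul_ofReal_eq_of_condExp {m m0 : MeasurableSpace Ω} (hm : m ≤ m0)
    {μ : Measure Ω} [IsFiniteMeasure μ] {f f' : Ω → ℝ}
    (hf : Measurable f) (hf' : Measurable f') (hint : Integrable f μ)
    (hf0 : 0 ≤ᵐ[μ] f) (hf0' : 0 ≤ᵐ[μ] f') (h : μ[f | m] =ᵐ[μ] f')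
    {g : Ω → ENNReal} (hg : Measurable[m] g) :
    ∫⁻ ω, ENNReal.ofReal (f ω) * g ω ∂μ = ∫⁻ ω, ENNReal.ofReal (f' ω) * g ω ∂μ := by
  have hint' : Integrable f' μ := integrable_condExp.congr h
  have htrim : (μ.withDensity fun ω => ENNReal.ofReal (f ω)).trim hm
      = (μ.withDensity fun ω => ENNReal.ofReal (f' ω)).trim hm := by
    refine @Measure.ext _ m _ _ fun s hs => ?_
    rw [trim_measurableSet_eq hm hs, trim_measurableSet_eq hm hs,
      withDensity_apply _ (hm s hs), withDensity_apply _ (hm s hs),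
      ← ofReal_integral_eq_lintegral_ofReal hint.integrableOn (ae_restrict_of_ae hf0),
      ← ofReal_integral_eq_lintegral_ofReal hint'.integrableOn (ae_restrict_of_ae hf0'),
      ← setIntegral_condExp hm hint hs]
    congr 1
    exact integral_congr_ae (ae_restrict_of_ae h)
  have hg' : Measurable g := hg.mono hm le_rfl
  have e1 := lintegral_withDensity_eq_lintegral_mul μ hf.ennreal_ofReal hg'
  have e2 := lintegral_withDensity_eq_lintegral_mul μ hf'.ennreal_ofReal hg'
  simp only [Pi.mul_apply] at e1 e2
  rw [← e1, ← e2, ← lintegral_trim hm hg, htrim, lintegral_trim hm hg]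

/-- Exponential moment bound for the number of occurrences of events whose conditional
probabilities given the past are at least `η`. -/
theorem integral_exp_neg_sum_indicator_le [m0 : MeasurableSpace Ω] {μ : Measure Ω}
    [IsProbabilityMeasure μ] {ℱ : ℕ → MeasurableSpace Ω} (hℱ : ∀ t, ℱ t ≤ m0)
    {A : ℕ → Set Ω} (hA : ∀ s t, s < t → MeasurableSet[ℱ t] (A s)) {η θ : ℝ} (hθ : 0 ≤ θ)
    (hη : ∀ t, ∀ᵐ ω ∂μ, η ≤ (μ[(A t).indicator (fun _ => (1 : ℝ)) | ℱ t]) ω) (n : ℕ) :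
    ∫ ω, Real.exp (-(θ * ∑ s ∈ Finset.range n, (A s).indicator (fun _ => (1 : ℝ)) ω)) ∂μ
      ≤ Real.exp (-(η * (1 - Real.exp (-θ)) * n)) := by
  induction n with
  | zero => simp
  | succ n ih =>
    set I : Ω → ℝ := (A n).indicator (fun _ => (1 : ℝ)) with hI
    set W : Ω → ℝ := fun ω =>
      Real.exp (-(θ * ∑ s ∈ Finset.range n, (A s).indicator (fun _ => (1 : ℝ)) ω)) with hW
    have hq : 0 ≤ 1 - Real.exp (-θ) := by
      have : Real.exp (-θ) ≤ 1 := Real.exp_le_one_iff.2 (by linarith)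
      linarith
    have hWm : Measurable[ℱ n] W := by
      refine Real.measurable_exp.comp (Measurable.neg (Measurable.const_mul ?_ θ))
      exact Finset.measurable_fun_sum _ fun s hs =>
        measurable_const.indicator (hA s n (Finset.mem_range.1 hs))
    have hW1 : ∀ ω, ‖W ω‖ ≤ 1 := fun ω => by
      rw [Real.norm_of_nonneg (Real.exp_nonneg _)]
      refine Real.exp_le_one_iff.2 (neg_nonpos.2 (mul_nonneg hθ (Finset.sum_nonneg fun s _ => ?_)))
      exact Set.indicator_nonneg (fun _ _ => zero_le_one) _
    have hWi : Integrable W μ :=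
      Integrable.of_bound (hWm.mono (hℱ n) le_rfl).aestronglyMeasurable 1 (ae_of_all _ hW1)
    have hAn : MeasurableSet (A n) := hℱ (n + 1) _ (hA n (n + 1) n.lt_succ_self)
    have hIi : Integrable I μ := (integrable_const (1 : ℝ)).indicator hAn
    have hWI : Integrable (W * I) μ :=
      hIi.bdd_mul (hWm.mono (hℱ n) le_rfl).aestronglyMeasurable (ae_of_all _ hW1)
    have hpull : μ[W * I | ℱ n] =ᵐ[μ] W * μ[I | ℱ n] :=
      condExp_mul_of_stronglyMeasurable_left hWm.stronglyMeasurable hWI hIi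
    have hlow : η * ∫ ω, W ω ∂μ ≤ ∫ ω, (W * I) ω ∂μ := by
      rw [← integral_condExp (hℱ n) (f := W * I), ← integral_const_mul]
      refine integral_mono_ae (hWi.const_mul η) integrable_condExp ?_
      filter_upwards [hpull, hη n] with ω h1 h2
      rw [h1, Pi.mul_apply, mul_comm]
      exact mul_le_mul_of_nonneg_left h2 (Real.exp_nonneg _)
    have hsplit : ∀ ω, Real.exp (-(θ * ∑ s ∈ Finset.range (n + 1),
        (A s).indicator (fun _ => (1 : ℝ)) ω))
        = W ω - (1 - Real.exp (-θ)) * (W * I) ω := fun ω => by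
      rw [Finset.sum_range_succ, mul_add, neg_add, Real.exp_add]
      change W ω * Real.exp (-(θ * I ω)) = _
      rw [Pi.mul_apply]
      by_cases hω : ω ∈ A n
      · simp [hI, hω]
        ring
      · simp [hI, hω]
    simp_rw [hsplit]
    rw [integral_sub hWi (hWI.const_mul _), integral_const_mul]
    have hW0 : 0 ≤ ∫ ω, W ω ∂μ := integral_nonneg fun ω => Real.exp_nonneg _
    have hstep : ∫ ω, W ω ∂μ - (1 - Real.exp (-θ)) * ∫ ω, (W * I) ω ∂μ
        ≤ (∫ ω, W ω ∂μ) * Real.exp (-(η * (1 - Real.exp (-θ)))) := by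
      have h1 := mul_le_mul_of_nonneg_left hlow hq
      have h2 := mul_le_mul_of_nonneg_left
        (Real.one_sub_le_exp_neg (η * (1 - Real.exp (-θ)))) hW0
      linarith
    refine hstep.trans ((mul_le_mul_of_nonneg_right ih (Real.exp_nonneg _)).trans_eq ?_)
    rw [← Real.exp_add]
    push_cast
    ring_nf

/-- Chernoff bound for the number of occurrences of events whose conditional probabilities
given the past are at least `η`. -/
theorem measureReal_sum_indicator_le_le [m0 : MeasurableSpace Ω] {μ : Measure Ω}
    [IsProbabilityMeasure μ] {ℱ : ℕ → MeasurableSpace Ω} (hℱ : ∀ t, ℱ t ≤ m0)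
    {A : ℕ → Set Ω} (hA : ∀ s t, s < t → MeasurableSet[ℱ t] (A s)) {η ε : ℝ}
    (hη0 : 0 ≤ η) (hε : 0 ≤ ε)
    (hη : ∀ t, ∀ᵐ ω ∂μ, η ≤ (μ[(A t).indicator (fun _ => (1 : ℝ)) | ℱ t]) ω) (n : ℕ) :
    μ.real {ω | ∑ s ∈ Finset.range n, (A s).indicator (fun _ => (1 : ℝ)) ω
        ≤ (1 - ε / 2) * η * n}
      ≤ Real.exp (-(η * ε ^ 2 / 16 * n)) := by
  set θ : ℝ := ε / 4 with hθ
  have hθ0 : 0 ≤ θ := by positivity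
  set N : Ω → ℝ := fun ω => ∑ s ∈ Finset.range n, (A s).indicator (fun _ => (1 : ℝ)) ω
  have hNm : Measurable N := Finset.measurable_fun_sum _ fun s _ =>
    measurable_const.indicator (hℱ (s + 1) _ (hA s (s + 1) s.lt_succ_self))
  have hN0 : ∀ ω, 0 ≤ N ω := fun ω =>
    Finset.sum_nonneg fun s _ => Set.indicator_nonneg (fun _ _ => zero_le_one) _
  have hint : Integrable (fun ω => Real.exp (-(θ * N ω))) μ := by
    refine Integrable.of_bound
      (Real.measurable_exp.comp (hNm.const_mul θ).neg).aestronglyMeasurable 1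
      (ae_of_all _ fun ω => ?_)
    rw [Real.norm_of_nonneg (Real.exp_nonneg _)]
    exact Real.exp_le_one_iff.2 (neg_nonpos.2 (mul_nonneg hθ0 (hN0 ω)))
  set a : ℝ := (1 - ε / 2) * η * n with ha
  have hmarkov := mul_meas_ge_le_integral_of_nonneg
    (ae_of_all μ fun ω => Real.exp_nonneg (-(θ * N ω))) hint (Real.exp (-(θ * a)))
  have hsub : μ.real {ω | N ω ≤ a}
      ≤ μ.real {ω | Real.exp (-(θ * a)) ≤ Real.exp (-(θ * N ω))} :=
    measureReal_mono fun ω (hω : N ω ≤ a) =>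
      Real.exp_le_exp.2 (neg_le_neg (mul_le_mul_of_nonneg_left hω hθ0))
  have hlap := integral_exp_neg_sum_indicator_le hℱ hA hθ0 hη n
  have hexp : θ - θ ^ 2 ≤ 1 - Real.exp (-θ) := by
    have h1 : Real.exp (-θ) * Real.exp θ = 1 := by rw [← Real.exp_add]; simp
    have h2 := Real.add_one_le_exp θ
    have h3 : Real.exp (-θ) * (θ + 1) ≤ 1 :=
      (mul_le_mul_of_nonneg_left h2 (Real.exp_nonneg _)).trans_eq h1
    have h4 : (Real.exp (-θ) - (1 - θ + θ ^ 2)) * (θ + 1) ≤ 0 := by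
      nlinarith [pow_nonneg hθ0 3]
    nlinarith
  have hfin : Real.exp (-(η * (1 - Real.exp (-θ)) * n))
      ≤ Real.exp (-(θ * a)) * Real.exp (-(η * ε ^ 2 / 16 * n)) := by
    rw [← Real.exp_add]
    refine Real.exp_le_exp.2 ?_
    have := mul_le_mul_of_nonneg_left hexp (mul_nonneg hη0 (Nat.cast_nonneg (α := ℝ) n))
    rw [ha, hθ] at *
    nlinarith
  refine hsub.trans (le_of_mul_le_mul_left ?_ (Real.exp_pos (-(θ * a))))
  exact hmarkov.trans (hlap.trans hfin)

/-- For a step of a martingale with values in `(0, 1]`, the event `X' ≥ X ^ r` has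
probability at most `2 * a ^ (1 - r)` when the mean is at most `a`. -/
theorem measureReal_rpow_le_le {m m0 : MeasurableSpace Ω} (hm : m ≤ m0)
    {μ : Measure Ω} [IsProbabilityMeasure μ] {f f' : Ω → ℝ}
    (hf : Measurable f) (hf' : Measurable[m] f') (hint : Integrable f μ)
    (hf0 : ∀ᵐ ω ∂μ, 0 ≤ f ω) (hf0' : ∀ᵐ ω ∂μ, 0 < f' ω) (h : μ[f | m] =ᵐ[μ] f')
    {a r : ℝ} (ha : 0 < a) (hmean : ∫ ω, f' ω ∂μ ≤ a) (hr : r ≤ 1) (hr0 : 0 ≤ r) :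
    μ.real {ω | f' ω ^ r ≤ f ω} ≤ 2 * a ^ (1 - r) := by
  have hf'm : Measurable f' := hf'.mono hm le_rfl
  have hint' : Integrable f' μ := integrable_condExp.congr h
  have hgm : Measurable[m] fun ω => ENNReal.ofReal (f' ω ^ (-r)) :=
    ((hf'.pow_const (-r))).ennreal_ofReal
  have hkey := lintegral_mul_ofReal_eq_of_condExp hm hf hf'm hint hf0
    (hf0'.mono fun _ => le_of_lt) h hgm
  have hbound : ∫⁻ ω, ENNReal.ofReal (f' ω) * ENNReal.ofReal (f' ω ^ (-r)) ∂μ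
      ≤ ENNReal.ofReal (2 * a ^ (1 - r)) := by
    have hi : Integrable (fun ω => a ^ (1 - r) * (1 + f' ω / a)) μ :=
      ((integrable_const 1).add (hint'.div_const a)).const_mul _
    have hle : ∫ ω, a ^ (1 - r) * (1 + f' ω / a) ∂μ ≤ 2 * a ^ (1 - r) := by
      rw [integral_const_mul, integral_add (integrable_const 1) (hint'.div_const a),
        integral_div]
      simp only [integral_const, probReal_univ, smul_eq_mul, mul_one]
      have : (∫ ω, f' ω ∂μ) / a ≤ 1 := (div_le_one ha).2 hmean
      nlinarith [Real.rpow_nonneg ha.le (1 - r)]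
    refine le_trans ?_ (ENNReal.ofReal_le_ofReal hle)
    rw [ofReal_integral_eq_lintegral_ofReal hi
      (hf0'.mono fun ω hω => by simp only [Pi.zero_apply]; positivity)]
    refine lintegral_mono_ae (hf0'.mono fun ω hω => ?_)
    rw [← ENNReal.ofReal_mul hω.le]
    refine ENNReal.ofReal_le_ofReal ?_
    have h1 : f' ω * f' ω ^ (-r) = f' ω ^ (1 - r) := by
      rw [sub_eq_add_neg, Real.rpow_add hω, Real.rpow_one]
    have hy : 0 ≤ f' ω / a := by positivity
    have h2 : (f' ω / a) ^ (1 - r) ≤ 1 + f' ω / a := by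
      rcases le_total (f' ω / a) 1 with h | h
      · linarith [Real.rpow_le_one hy h (by linarith : 0 ≤ 1 - r)]
      · have := Real.rpow_le_rpow_of_exponent_le h (by linarith : 1 - r ≤ 1)
        rw [Real.rpow_one] at this
        linarith
    have h3 : f' ω ^ (1 - r) = a ^ (1 - r) * (f' ω / a) ^ (1 - r) := by
      rw [← Real.mul_rpow ha.le hy, mul_div_cancel₀ _ ha.ne']
    rw [h1, h3]
    exact mul_le_mul_of_nonneg_left h2 (Real.rpow_nonneg ha.le _)
  have hmarkov := mul_meas_ge_le_lintegral₀ (μ := μ)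
    (f := fun ω => ENNReal.ofReal (f ω) * ENNReal.ofReal (f' ω ^ (-r)))
    (hf.ennreal_ofReal.mul (hgm.mono hm le_rfl)).aemeasurable 1
  rw [one_mul, hkey] at hmarkov
  have hsub : μ {ω | f' ω ^ r ≤ f ω}
      ≤ μ {ω | 1 ≤ ENNReal.ofReal (f ω) * ENNReal.ofReal (f' ω ^ (-r))} := by
    refine measure_mono_ae (hf0'.mono fun ω hω (hle : f' ω ^ r ≤ f ω) => ?_)
    have hp := Real.rpow_pos_of_pos hω (-r)
    change 1 ≤ ENNReal.ofReal (f ω) * ENNReal.ofReal (f' ω ^ (-r))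
    rw [← ENNReal.ofReal_mul ((Real.rpow_nonneg hω.le r).trans hle), ENNReal.one_le_ofReal]
    calc (1 : ℝ) = f' ω ^ r * f' ω ^ (-r) := by rw [← Real.rpow_add hω]; simp
      _ ≤ _ := mul_le_mul_of_nonneg_right hle hp.le
  exact ENNReal.toReal_le_of_le_ofReal (by positivity) (hsub.trans (hmarkov.trans hbound))

/-- Deterministic growth: each step multiplies `y` by at least `r`, and by at least `b` at the
steps in `A`. -/
theorem mul_rpow_sum_indicator_le {y : ℕ → ℝ} {A : Set ℕ} {b r : ℝ} (hb : 1 ≤ b) (hr : 0 < r)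
    (hr1 : r ≤ 1) (hy : ∀ t, 0 ≤ y t) {n : ℕ} (hstep : ∀ t < n, r * y t ≤ y (t + 1))
    (hA : ∀ t < n, t ∈ A → b * y t ≤ y (t + 1)) :
    y 0 * (b ^ (∑ s ∈ Finset.range n, A.indicator (fun _ => (1 : ℝ)) s) * r ^ n) ≤ y n := by
  induction n with
  | zero => simp
  | succ n ih =>
    have ih' := ih (fun t ht => hstep t (ht.trans n.lt_succ_self))
      (fun t ht => hA t (ht.trans n.lt_succ_self))
    have hb0 : 0 < b := by linarith
    rw [Finset.sum_range_succ, Real.rpow_add hb0, pow_succ]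
    by_cases hn : n ∈ A
    · rw [Set.indicator_of_mem hn, Real.rpow_one]
      have h1 := hA n n.lt_succ_self hn
      have h2 : b * r * (y 0 * (b ^ (∑ s ∈ Finset.range n, A.indicator (fun _ => (1 : ℝ)) s)
          * r ^ n)) ≤ b * r * y n := mul_le_mul_of_nonneg_left ih' (by positivity)
      have h3 : b * y n * r ≤ b * y n :=
        mul_le_of_le_one_right (mul_nonneg hb0.le (hy n)) hr1
      linarith
    · rw [Set.indicator_of_notMem hn, Real.rpow_zero]
      have h1 := hstep n n.lt_succ_self
      have h2 := mul_le_mul_of_nonneg_left ih' hr.le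
      linarith

/-- A `(0, 1]`-valued sequence with no step `x (t + 1) ≥ x t ^ r` and sufficiently many steps
`x (t + 1) < x t ^ b` is small at time `n`. -/
theorem log_lt_neg_rpow {x : ℕ → ℝ} {b η ε γ : ℝ} {n : ℕ} (hb : 1 < b) (hη : 0 < η) (hε : 0 < ε)
    (hx : ∀ t, x t ∈ Set.Ioc (0 : ℝ) 1) (hx0 : x 0 < Real.exp (-(γ * n))) (hn : 1 ≤ γ * n)
    (hstep : ∀ t < n, x (t + 1) < x t ^ (b ^ (-(ε * η / 4))))
    (hsum : (1 - ε / 2) * η * n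
      < ∑ s ∈ Finset.range n, {t | x (t + 1) < x t ^ b}.indicator (fun _ => (1 : ℝ)) s) :
    Real.log (x n) < -(b ^ ((1 - ε) * η * n)) := by
  have hb0 : 0 < b := by linarith
  have hlog : ∀ t p, x (t + 1) < x t ^ p → p * -Real.log (x t) ≤ -Real.log (x (t + 1)) := by
    intro t p h
    have := Real.log_lt_log (hx (t + 1)).1 h
    rw [Real.log_rpow (hx t).1] at this
    linarith
  have hgrow := mul_rpow_sum_indicator_le (y := fun t => -Real.log (x t))
    (A := {t | x (t + 1) < x t ^ b}) (n := n) hb.le (Real.rpow_pos_of_pos hb0 (-(ε * η / 4)))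
    (Real.rpow_le_one_of_one_le_of_nonpos hb.le (by nlinarith))
    (fun t => neg_nonneg.2 (Real.log_nonpos (hx t).1.le (hx t).2))
    (fun t ht => hlog t _ (hstep t ht)) (fun t _ h => hlog t b h)
  have h0 : 1 < -Real.log (x 0) := by
    have := Real.log_lt_log (hx 0).1 hx0
    rw [Real.log_exp] at this
    linarith
  rw [← Real.rpow_mul_natCast hb0.le, ← Real.rpow_add hb0] at hgrow
  have hn0 : (0 : ℝ) ≤ n := Nat.cast_nonneg n
  have hpow : b ^ ((1 - ε) * η * n) ≤
      b ^ ((∑ s ∈ Finset.range n, {t | x (t + 1) < x t ^ b}.indicator (fun _ => (1 : ℝ)) s)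
        + -(ε * η / 4) * n) := by
    refine Real.rpow_le_rpow_of_exponent_le hb.le ?_
    have : 0 ≤ ε * η * n := by positivity
    linarith
  have hpos := Real.rpow_pos_of_pos hb0 ((1 - ε) * η * n)
  nlinarith

end Auxiliary

/-- for all `η ∈ (0,1]`, `b > 1`, `ε ∈ (0,1)`, `γ > 0` there are `α < ∞`
and `c > 0` such that for every `(0,1]`-valued martingale with
`ℙ[X_{t+1} < X_t^b | X_0,…,X_t] ≥ η` a.s., and every `T ≥ 1` with `X_0 < exp(-γ·T)`
a.s., we have `ℙ[log X_T ≥ -b^{(1-ε)·η·T}] ≤ α·exp(-c·T)`. -/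
theorem stmt2 (η b ε γ : ℝ) (hη : 0 < η) (hη1 : η ≤ 1) (hb : 1 < b)
    (hε : 0 < ε) (hε1 : ε < 1) (hγ : 0 < γ) :
    ∃ α c : ℝ, 0 < c ∧
    ∀ (Ω : Type) [MeasurableSpace Ω] (μ : Measure Ω) [IsProbabilityMeasure μ]
      (X : ℕ → Ω → ℝ),
      (∀ t, Measurable (X t)) →
      (∀ t, ∀ᵐ ω ∂μ, X t ω ∈ Set.Ioc (0 : ℝ) 1) →
      (∀ t, μ[X (t + 1) | pastSigma X t] =ᵐ[μ] X t) →
      (∀ t, ∀ᵐ ω ∂μ,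
        η ≤ (μ[Set.indicator {ω' | X (t + 1) ω' < X t ω' ^ b}
              (fun _ => (1 : ℝ)) | pastSigma X t]) ω) →
      ∀ T : ℕ, 1 ≤ T →
        (∀ᵐ ω ∂μ, X 0 ω < Real.exp (-(γ * (T : ℝ)))) →
        (μ {ω | -(b ^ ((1 - ε) * η * (T : ℝ))) ≤ Real.log (X T ω)}).toReal
          ≤ α * Real.exp (-(c * (T : ℝ))) := by
  have hb0 : 0 < b := by linarith
  set r : ℝ := b ^ (-(ε * η / 4))
  have hr0 : 0 < r := Real.rpow_pos_of_pos hb0 _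
  have hr1 : r < 1 := Real.rpow_lt_one_of_one_lt_of_neg hb (by
    have := mul_pos hε hη
    linarith)
  set k : ℝ := γ * (1 - r) with hk
  have hk0 : 0 < k := mul_pos hγ (by linarith)
  set c : ℝ := min (k / 2) (η * ε ^ 2 / 16)
  have hc0 : 0 < c := lt_min (by positivity) (by positivity)
  refine ⟨4 / k + 1 + Real.exp (c / γ), c, hc0, ?_⟩
  intro Ω _ μ _ X hXm hX hmart hsucc T hT hX0
  have hT0 : (0 : ℝ) ≤ T := Nat.cast_nonneg T
  have hecT := Real.exp_pos (-(c * (T : ℝ)))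
  rcases lt_or_ge (γ * T) 1 with hsmall | hlarge
  · have h1 : (1 : ℝ) ≤ Real.exp (c / γ) * Real.exp (-(c * (T : ℝ))) := by
      rw [← Real.exp_add]
      refine Real.one_le_exp ?_
      have h2 : (T : ℝ) ≤ 1 / γ := by
        rw [le_div_iff₀ hγ]
        linarith
      have h3 := mul_le_mul_of_nonneg_left h2 hc0.le
      rw [mul_one_div] at h3
      linarith
    have h4 : 0 ≤ (4 / k + 1) * Real.exp (-(c * (T : ℝ))) := by positivity
    have h5 : (μ {ω | -(b ^ ((1 - ε) * η * (T : ℝ))) ≤ Real.log (X T ω)}).toReal ≤ 1 :=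
      measureReal_le_one
    linarith
  · set A : ℕ → Set Ω := fun t => {ω | X (t + 1) ω < X t ω ^ b}
    set B : ℕ → Set Ω := fun t => {ω | X t ω ^ r ≤ X (t + 1) ω}
    set F : Set Ω := {ω | ∑ s ∈ Finset.range T, (A s).indicator (fun _ => (1 : ℝ)) ω
        ≤ (1 - ε / 2) * η * T}
    have hAm : ∀ s t, s < t → MeasurableSet[pastSigma X t] (A s) := fun s t hst =>
      @measurableSet_lt _ _ _ _ _ (pastSigma X t) _ _ _ _ _ (measurable_pastSigma X hst)
        ((measurable_pastSigma X hst.le).pow_const b)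
    have hFle : μ.real F ≤ Real.exp (-(η * ε ^ 2 / 16 * T)) :=
      measureReal_sum_indicator_le_le (pastSigma_le hXm) hAm hη.le hε.le hsucc T
    have hXint : ∀ t, Integrable (X t) μ := fun t =>
      Integrable.of_bound (hXm t).aestronglyMeasurable 1 ((hX t).mono fun ω hω => by
        rw [Real.norm_of_nonneg hω.1.le]
        exact hω.2)
    have hmean : ∀ t, ∫ ω, X t ω ∂μ ≤ Real.exp (-(γ * T)) := by
      intro t
      induction t with
      | zero =>
        have := integral_mono_ae (hXint 0) (integrable_const (Real.exp (-(γ * (T : ℝ)))))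
          (hX0.mono fun _ => le_of_lt)
        simpa using this
      | succ t ih =>
        rwa [← integral_condExp (pastSigma_le hXm t) (f := X (t + 1)),
          integral_congr_ae (hmart t)]
    have hBle : ∀ t, μ.real (B t) ≤ 2 * Real.exp (-(k * T)) := fun t => by
      have := measureReal_rpow_le_le (pastSigma_le hXm t) (hXm (t + 1))
        (measurable_pastSigma X le_rfl) (hXint (t + 1)) ((hX (t + 1)).mono fun _ h => h.1.le)
        ((hX t).mono fun _ h => h.1) (hmart t) (Real.exp_pos _) (hmean t) hr1.le hr0.le
      rw [← Real.exp_mul] at this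
      refine this.trans_eq ?_
      rw [hk]
      ring_nf
    have hsub : μ.real {ω | -(b ^ ((1 - ε) * η * (T : ℝ))) ≤ Real.log (X T ω)}
        ≤ μ.real ((⋃ t ∈ Finset.range T, B t) ∪ F) := by
      refine ENNReal.toReal_mono (measure_ne_top _ _) (measure_mono_ae ?_)
      filter_upwards [ae_all_iff.2 hX, hX0] with ω hω hω0 hle
      by_contra hcon
      replace hcon : ω ∉ (⋃ t ∈ Finset.range T, B t) ∪ F := hcon
      simp only [Set.mem_union, Set.mem_iUnion, not_or, not_exists,
        Finset.mem_range] at hcon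
      have := log_lt_neg_rpow (x := fun t => X t ω) hb hη hε hω hω0 hlarge
        (fun t ht => not_le.1 (hcon.1 t ht)) (not_le.1 hcon.2)
      exact absurd hle (not_le.2 this)
    have hU : μ.real (⋃ t ∈ Finset.range T, B t) ≤ T * (2 * Real.exp (-(k * T))) := by
      refine (measureReal_biUnion_finset_le _ _).trans ?_
      refine (Finset.sum_le_sum fun t _ => hBle t).trans_eq ?_
      simp
    have hdecay : (T : ℝ) * (2 * Real.exp (-(k * T))) ≤ 4 / k * Real.exp (-(c * T)) := by
      have h1 : k / 2 * T ≤ Real.exp (k / 2 * T) := by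
        linarith [Real.add_one_le_exp (k / 2 * (T : ℝ))]
      have h2 : Real.exp (-(k * T)) * Real.exp (k / 2 * T) = Real.exp (-(k / 2 * T)) := by
        rw [← Real.exp_add]
        ring_nf
      have h3 : Real.exp (-(k / 2 * T)) ≤ Real.exp (-(c * T)) :=
        Real.exp_le_exp.2 (neg_le_neg (mul_le_mul_of_nonneg_right (min_le_left _ _) hT0))
      calc (T : ℝ) * (2 * Real.exp (-(k * T)))
          = 4 / k * (Real.exp (-(k * T)) * (k / 2 * T)) := by field_simp; ring
        _ ≤ 4 / k * (Real.exp (-(k * T)) * Real.exp (k / 2 * T)) := by gcongr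
        _ ≤ 4 / k * Real.exp (-(c * T)) := by
          rw [h2]
          gcongr
    have hF' : Real.exp (-(η * ε ^ 2 / 16 * T)) ≤ Real.exp (-(c * T)) :=
      Real.exp_le_exp.2 (neg_le_neg (mul_le_mul_of_nonneg_right (min_le_right _ _) hT0))
    have hun := measureReal_union_le (μ := μ) (⋃ t ∈ Finset.range T, B t) F
    have hpos : 0 ≤ Real.exp (c / γ) * Real.exp (-(c * (T : ℝ))) := by positivity
    change μ.real _ ≤ _
    linarith
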